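/- Assume f, g are twice continuously differentiable and −f(x,·), g_i(x,·) are convex on ℝᵐ for all x near x̄. Let ȳ ∈ S(x̄) and λ̄ ∈ Σ(x̄,ȳ). Suppose either (i) f and g are separable with respect to x and y (f(x,y) = f₁(x) + f₂(y) and g(x,y) = g₁(x) + g₂(y)) and a CQ holds at (x̄,ȳ,λ̄) for the constraint system {(x,y,λ) : ∇_y L(x,y,λ) = 0, λ ≥ 0}, or (ii) SOSC holds at (ȳ,λ̄) for problem (P_x̄). Then ∂̂V(x̄) ⊆ {∇_x L(x̄,ȳ,λ̄)}. -/

import Mathlib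

open Filter Topology Metric RealInnerProductSpace

noncomputable section

/-- Feasible region of the parametric maximization problem. -/
def Feas {n m q : ℕ} (g : EuclideanSpace ℝ (Fin n) → EuclideanSpace ℝ (Fin m) → Fin q → ℝ)
    (x : EuclideanSpace ℝ (Fin n)) : Set (EuclideanSpace ℝ (Fin m)) :=
  {y | ∀ i, g x y i ≤ 0}

/-- Maximal value function (EReal valued; `sSup ∅ = ⊥ = -∞`). -/
def Vfun {n m q : ℕ} (f : EuclideanSpace ℝ (Fin n) → EuclideanSpace ℝ (Fin m) → ℝ)
    (g : EuclideanSpace ℝ (Fin n) → EuclideanSpace ℝ (Fin m) → Fin q → ℝ)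
    (x : EuclideanSpace ℝ (Fin n)) : EReal :=
  sSup ((fun y => (f x y : EReal)) '' Feas g x)

/-- Solution map of the parametric maximization problem. -/
def Sol {n m q : ℕ} (f : EuclideanSpace ℝ (Fin n) → EuclideanSpace ℝ (Fin m) → ℝ)
    (g : EuclideanSpace ℝ (Fin n) → EuclideanSpace ℝ (Fin m) → Fin q → ℝ)
    (x : EuclideanSpace ℝ (Fin n)) : Set (EuclideanSpace ℝ (Fin m)) :=
  {y ∈ Feas g x | (f x y : EReal) = Vfun f g x}

/-- Lagrangian `L(x,y,λ) = f(x,y) - λᵀ g(x,y)`. -/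
def Lag {n m q : ℕ} (f : EuclideanSpace ℝ (Fin n) → EuclideanSpace ℝ (Fin m) → ℝ)
    (g : EuclideanSpace ℝ (Fin n) → EuclideanSpace ℝ (Fin m) → Fin q → ℝ)
    (x : EuclideanSpace ℝ (Fin n)) (y : EuclideanSpace ℝ (Fin m)) (lam : Fin q → ℝ) : ℝ :=
  f x y - ∑ i, lam i * g x y i

/-- Partial gradient in `x`. -/
def gradx {n m : ℕ} (φ : EuclideanSpace ℝ (Fin n) → EuclideanSpace ℝ (Fin m) → ℝ)
    (x : EuclideanSpace ℝ (Fin n)) (y : EuclideanSpace ℝ (Fin m)) : EuclideanSpace ℝ (Fin n) :=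
  gradient (fun x' => φ x' y) x

/-- Partial gradient in `y`. -/
def grady {n m : ℕ} (φ : EuclideanSpace ℝ (Fin n) → EuclideanSpace ℝ (Fin m) → ℝ)
    (x : EuclideanSpace ℝ (Fin n)) (y : EuclideanSpace ℝ (Fin m)) : EuclideanSpace ℝ (Fin m) :=
  gradient (fun y' => φ x y') y

/-- `∇_y L(x,y,λ)`. -/
def gradyL {n m q : ℕ} (f : EuclideanSpace ℝ (Fin n) → EuclideanSpace ℝ (Fin m) → ℝ)
    (g : EuclideanSpace ℝ (Fin n) → EuclideanSpace ℝ (Fin m) → Fin q → ℝ)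
    (x : EuclideanSpace ℝ (Fin n)) (y : EuclideanSpace ℝ (Fin m)) (lam : Fin q → ℝ) :
    EuclideanSpace ℝ (Fin m) :=
  grady (fun x y => Lag f g x y lam) x y

/-- `∇_x L(x,y,λ)`. -/
def gradxL {n m q : ℕ} (f : EuclideanSpace ℝ (Fin n) → EuclideanSpace ℝ (Fin m) → ℝ)
    (g : EuclideanSpace ℝ (Fin n) → EuclideanSpace ℝ (Fin m) → Fin q → ℝ)
    (x : EuclideanSpace ℝ (Fin n)) (y : EuclideanSpace ℝ (Fin m)) (lam : Fin q → ℝ) :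
    EuclideanSpace ℝ (Fin n) :=
  gradx (fun x y => Lag f g x y lam) x y

/-- `∇_y g(x,y)ᵀ u ∈ ℝ^q`. -/
def gyTu {n m q : ℕ} (g : EuclideanSpace ℝ (Fin n) → EuclideanSpace ℝ (Fin m) → Fin q → ℝ)
    (x : EuclideanSpace ℝ (Fin n)) (y : EuclideanSpace ℝ (Fin m)) (u : EuclideanSpace ℝ (Fin m)) :
    Fin q → ℝ :=
  fun i => ⟪grady (fun x y => g x y i) x y, u⟫

/-- `∇²_{yy} L(x,y,λ) u`. -/
def hessyyLu {n m q : ℕ} (f : EuclideanSpace ℝ (Fin n) → EuclideanSpace ℝ (Fin m) → ℝ)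
    (g : EuclideanSpace ℝ (Fin n) → EuclideanSpace ℝ (Fin m) → Fin q → ℝ)
    (x : EuclideanSpace ℝ (Fin n)) (y : EuclideanSpace ℝ (Fin m)) (lam : Fin q → ℝ)
    (u : EuclideanSpace ℝ (Fin m)) : EuclideanSpace ℝ (Fin m) :=
  gradient (fun y' => ⟪gradyL f g x y' lam, u⟫) y

/-- `∇²_{xy} L(x,y,λ) u ∈ ℝⁿ` (for `u ∈ ℝᵐ`). -/
def hessxyLu {n m q : ℕ} (f : EuclideanSpace ℝ (Fin n) → EuclideanSpace ℝ (Fin m) → ℝ)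
    (g : EuclideanSpace ℝ (Fin n) → EuclideanSpace ℝ (Fin m) → Fin q → ℝ)
    (x : EuclideanSpace ℝ (Fin n)) (y : EuclideanSpace ℝ (Fin m)) (lam : Fin q → ℝ)
    (u : EuclideanSpace ℝ (Fin m)) : EuclideanSpace ℝ (Fin n) :=
  gradient (fun x' => ⟪gradyL f g x' y lam, u⟫) x

/-- Multiplier set `Σ(x,y)`. -/
def SigmaSet {n m q : ℕ} (f : EuclideanSpace ℝ (Fin n) → EuclideanSpace ℝ (Fin m) → ℝ)
    (g : EuclideanSpace ℝ (Fin n) → EuclideanSpace ℝ (Fin m) → Fin q → ℝ)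
    (x : EuclideanSpace ℝ (Fin n)) (y : EuclideanSpace ℝ (Fin m)) : Set (Fin q → ℝ) :=
  {lam | gradyL f g x y lam = 0 ∧ (∀ i, 0 ≤ lam i) ∧ (∀ i, g x y i ≤ 0) ∧
    ∑ i, lam i * g x y i = 0}

/-- Singular multiplier set `Σ⁰(x,y)`. -/
def SigmaZero {n m q : ℕ} (g : EuclideanSpace ℝ (Fin n) → EuclideanSpace ℝ (Fin m) → Fin q → ℝ)
    (x : EuclideanSpace ℝ (Fin n)) (y : EuclideanSpace ℝ (Fin m)) : Set (Fin q → ℝ) :=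
  {lam | ∑ i, lam i • grady (fun x y => g x y i) x y = 0 ∧ (∀ i, 0 ≤ lam i) ∧
    (∀ i, g x y i ≤ 0) ∧ ∑ i, lam i * g x y i = 0}

/-- The set `Ξ^r(x,y,λ)`. -/
def XiSet {n m q : ℕ} (r : ℝ) (f : EuclideanSpace ℝ (Fin n) → EuclideanSpace ℝ (Fin m) → ℝ)
    (g : EuclideanSpace ℝ (Fin n) → EuclideanSpace ℝ (Fin m) → Fin q → ℝ)
    (x : EuclideanSpace ℝ (Fin n)) (y : EuclideanSpace ℝ (Fin m)) (lam : Fin q → ℝ) :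
    Set (EuclideanSpace ℝ (Fin m)) :=
  {u | hessyyLu f g x y lam u = 0 ∧ (∀ i, 0 ≤ -(gyTu g x y u i) - r * g x y i) ∧
    (∀ i, 0 ≤ lam i) ∧ ∑ i, lam i * (-(gyTu g x y u i) - r * g x y i) = 0}

/-- Fréchet (regular) subdifferential of an `EReal` valued function. -/
def FSub {n : ℕ} (φ : EuclideanSpace ℝ (Fin n) → EReal) (x₀ : EuclideanSpace ℝ (Fin n)) :
    Set (EuclideanSpace ℝ (Fin n)) :=
  {v | ∃ c : ℝ, φ x₀ = (c : EReal) ∧ ∀ ε : ℝ, 0 < ε → ∃ δ : ℝ, 0 < δ ∧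
    ∀ x, ‖x - x₀‖ < δ → ((c + ⟪v, x - x₀⟫ - ε * ‖x - x₀‖ : ℝ) : EReal) ≤ φ x}

/-- Limiting (Mordukhovich) subdifferential. -/
def LSub {n : ℕ} (φ : EuclideanSpace ℝ (Fin n) → EReal) (x₀ : EuclideanSpace ℝ (Fin n)) :
    Set (EuclideanSpace ℝ (Fin n)) :=
  {v | ∃ (xk : ℕ → EuclideanSpace ℝ (Fin n)) (vk : ℕ → EuclideanSpace ℝ (Fin n)),
    (∀ k, vk k ∈ FSub φ (xk k)) ∧ Tendsto xk atTop (𝓝 x₀) ∧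
    Tendsto (fun k => φ (xk k)) atTop (𝓝 (φ x₀)) ∧ Tendsto vk atTop (𝓝 v)}

/-- Horizon (singular) subdifferential. -/
def HorSub {n : ℕ} (φ : EuclideanSpace ℝ (Fin n) → EReal) (x₀ : EuclideanSpace ℝ (Fin n)) :
    Set (EuclideanSpace ℝ (Fin n)) :=
  {v | ∃ (xk : ℕ → EuclideanSpace ℝ (Fin n)) (vk : ℕ → EuclideanSpace ℝ (Fin n)) (tk : ℕ → ℝ),
    (∀ k, vk k ∈ FSub φ (xk k)) ∧ (∀ k, 0 < tk k) ∧ Tendsto tk atTop (𝓝 0) ∧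
    Tendsto xk atTop (𝓝 x₀) ∧ Tendsto (fun k => φ (xk k)) atTop (𝓝 (φ x₀)) ∧
    Tendsto (fun k => tk k • vk k) atTop (𝓝 v)}

/-- Clarke subdifferential (for locally Lipschitz functions): convex hull of the limiting one. -/
def CSub {n : ℕ} (φ : EuclideanSpace ℝ (Fin n) → EReal) (x₀ : EuclideanSpace ℝ (Fin n)) :
    Set (EuclideanSpace ℝ (Fin n)) :=
  convexHull ℝ (LSub φ x₀)

/-- `φ` is (finite-valued and) Lipschitz continuous near `x₀`. -/
def LipschitzNearAt {n : ℕ} (φ : EuclideanSpace ℝ (Fin n) → EReal)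
    (x₀ : EuclideanSpace ℝ (Fin n)) : Prop :=
  ∃ δ : ℝ, 0 < δ ∧ ∃ K : NNReal, ∃ ψ : EuclideanSpace ℝ (Fin n) → ℝ,
    LipschitzWith K ψ ∧ ∀ x ∈ ball x₀ δ, φ x = (ψ x : EReal)

/-- Regular (Fréchet) normal cone. -/
def regNC {n : ℕ} (C : Set (EuclideanSpace ℝ (Fin n))) (x₀ : EuclideanSpace ℝ (Fin n)) :
    Set (EuclideanSpace ℝ (Fin n)) :=
  {ξ | ∀ ε : ℝ, 0 < ε → ∃ δ : ℝ, 0 < δ ∧ ∀ x ∈ C, ‖x - x₀‖ < δ →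
    ⟪ξ, x - x₀⟫ ≤ ε * ‖x - x₀‖}

/-- Limiting (Mordukhovich) normal cone. -/
def limNC {n : ℕ} (C : Set (EuclideanSpace ℝ (Fin n))) (x₀ : EuclideanSpace ℝ (Fin n)) :
    Set (EuclideanSpace ℝ (Fin n)) :=
  {ξ | ∃ (xk : ℕ → EuclideanSpace ℝ (Fin n)) (ξk : ℕ → EuclideanSpace ℝ (Fin n)),
    (∀ k, xk k ∈ C) ∧ (∀ k, ξk k ∈ regNC C (xk k)) ∧
    Tendsto xk atTop (𝓝 x₀) ∧ Tendsto ξk atTop (𝓝 ξ)}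

/-- Inner semicontinuity of the solution map at `(x̄, ȳ)`. -/
def InnerSemicont {n m q : ℕ} (f : EuclideanSpace ℝ (Fin n) → EuclideanSpace ℝ (Fin m) → ℝ)
    (g : EuclideanSpace ℝ (Fin n) → EuclideanSpace ℝ (Fin m) → Fin q → ℝ)
    (xb : EuclideanSpace ℝ (Fin n)) (yb : EuclideanSpace ℝ (Fin m)) : Prop :=
  ∀ xk : ℕ → EuclideanSpace ℝ (Fin n), Tendsto xk atTop (𝓝 xb) →
    ∃ yk : ℕ → EuclideanSpace ℝ (Fin m), (∀ k, yk k ∈ Sol f g (xk k)) ∧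
      Tendsto yk atTop (𝓝 yb)

/-- Local error bound for the system `g(x,y) ≤ 0` at `(x̄, ȳ)`. -/
def LocalErrorBound {n m q : ℕ}
    (g : EuclideanSpace ℝ (Fin n) → EuclideanSpace ℝ (Fin m) → Fin q → ℝ)
    (xb : EuclideanSpace ℝ (Fin n)) (yb : EuclideanSpace ℝ (Fin m)) : Prop :=
  ∃ κ δ : ℝ, 0 < κ ∧ 0 < δ ∧
    ∀ x y, ‖((x, y) : EuclideanSpace ℝ (Fin n) × EuclideanSpace ℝ (Fin m)) - (xb, yb)‖ < δ →
      Metric.infDist ((x, y) : EuclideanSpace ℝ (Fin n) × EuclideanSpace ℝ (Fin m))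
          {p : EuclideanSpace ℝ (Fin n) × EuclideanSpace ℝ (Fin m) | ∀ i, g p.1 p.2 i ≤ 0}
        ≤ κ * ∑ i, max (g x y i) 0

/-- MFCQ for the system `g(x̄, ·) ≤ 0` at `ȳ`. -/
def MFCQy {n m q : ℕ} (g : EuclideanSpace ℝ (Fin n) → EuclideanSpace ℝ (Fin m) → Fin q → ℝ)
    (xb : EuclideanSpace ℝ (Fin n)) (yb : EuclideanSpace ℝ (Fin m)) : Prop :=
  ∀ lam : Fin q → ℝ, (∀ i, 0 ≤ lam i) → (∑ i, lam i * g xb yb i = 0) →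
    (∀ i, g xb yb i ≤ 0) → (∑ i, lam i • grady (fun x y => g x y i) xb yb = 0) → lam = 0

/-- Restricted sup-compactness at `x̄`. -/
def RestrictedSupCompact {n m q : ℕ}
    (f : EuclideanSpace ℝ (Fin n) → EuclideanSpace ℝ (Fin m) → ℝ)
    (g : EuclideanSpace ℝ (Fin n) → EuclideanSpace ℝ (Fin m) → Fin q → ℝ)
    (xb : EuclideanSpace ℝ (Fin n)) : Prop :=
  (∃ c : ℝ, Vfun f g xb = (c : EReal)) ∧
  ∃ ε δ : ℝ, 0 < ε ∧ 0 < δ ∧ ∃ Ω : Set (EuclideanSpace ℝ (Fin m)), IsCompact Ω ∧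
    ∀ x, ‖x - xb‖ < δ → Vfun f g xb - (ε : EReal) < Vfun f g x → (Sol f g x ∩ Ω).Nonempty

/-- Robinson stability of the feasible map at `(x̄, ȳ)`. -/
def RobinsonStability {n m q : ℕ}
    (g : EuclideanSpace ℝ (Fin n) → EuclideanSpace ℝ (Fin m) → Fin q → ℝ)
    (xb : EuclideanSpace ℝ (Fin n)) (yb : EuclideanSpace ℝ (Fin m)) : Prop :=
  ∃ κ δ : ℝ, 0 < κ ∧ 0 < δ ∧
    ∀ x y, ‖((x, y) : EuclideanSpace ℝ (Fin n) × EuclideanSpace ℝ (Fin m)) - (xb, yb)‖ < δ →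
      Metric.infDist y (Feas g x) ≤ κ * ∑ i, max (g x y i) 0

/-- A constraint qualification holds at the feasible point `w₀` of the system
`{w : G w ≤ 0, H w = 0}`: local minimizers of C¹ functions over the feasible set
satisfy the KKT conditions. -/
def CQAt {W : Type} [NormedAddCommGroup W] [NormedSpace ℝ W] {p p' : ℕ}
    (G : W → Fin p → ℝ) (H : W → Fin p' → ℝ) (w₀ : W) : Prop :=
  ∀ θ : W → ℝ, ContDiff ℝ 1 θ →
    IsLocalMinOn θ {w | (∀ i, G w i ≤ 0) ∧ ∀ j, H w j = 0} w₀ →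
    ∃ (lam : Fin p → ℝ) (mu : Fin p' → ℝ), (∀ i, 0 ≤ lam i) ∧
      (fderiv ℝ θ w₀ + ∑ i, lam i • fderiv ℝ (fun w => G w i) w₀ +
        ∑ j, mu j • fderiv ℝ (fun w => H w j) w₀ = 0) ∧
      ∑ i, lam i * G w₀ i = 0

/-- Inequality constraints of the Wolfe dual system (`λ ≥ 0`). -/
def WolfeG (n m q : ℕ) :
    (EuclideanSpace ℝ (Fin n) × EuclideanSpace ℝ (Fin m) × (Fin q → ℝ)) → Fin q → ℝ :=
  fun w i => -(w.2.2 i)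

/-- Equality constraints of the Wolfe dual system (`∇_y L(x,y,λ) = 0`). -/
def WolfeH {n m q : ℕ} (f : EuclideanSpace ℝ (Fin n) → EuclideanSpace ℝ (Fin m) → ℝ)
    (g : EuclideanSpace ℝ (Fin n) → EuclideanSpace ℝ (Fin m) → Fin q → ℝ) :
    (EuclideanSpace ℝ (Fin n) × EuclideanSpace ℝ (Fin m) × (Fin q → ℝ)) → Fin m → ℝ :=
  fun w j => gradyL f g w.1 w.2.1 w.2.2 j

/-- The multiplier set `M(β, x, y)` of the parametric program. -/
def MultSetP {n m q : ℕ} (g : EuclideanSpace ℝ (Fin n) → EuclideanSpace ℝ (Fin m) → Fin q → ℝ)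
    (β : EuclideanSpace ℝ (Fin m)) (x : EuclideanSpace ℝ (Fin n))
    (y : EuclideanSpace ℝ (Fin m)) : Set (Fin q → ℝ) :=
  {lam | β - ∑ i, lam i • grady (fun x y => g x y i) x y = 0 ∧ (∀ i, 0 ≤ lam i) ∧
    ∑ i, lam i * g x y i = 0 ∧ ∀ i, g x y i ≤ 0}

/-- A stable parametric CQ holds at `ȳ ∈ F(x̄)` for the parametric system `g(x,·) ≤ 0`. -/
def StableParamCQ {n m q : ℕ} (f : EuclideanSpace ℝ (Fin n) → EuclideanSpace ℝ (Fin m) → ℝ)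
    (g : EuclideanSpace ℝ (Fin n) → EuclideanSpace ℝ (Fin m) → Fin q → ℝ)
    (xb : EuclideanSpace ℝ (Fin n)) (yb : EuclideanSpace ℝ (Fin m)) : Prop :=
  ∃ P : EuclideanSpace ℝ (Fin n) → EuclideanSpace ℝ (Fin m) → Prop,
    (∃ δ : ℝ, 0 < δ ∧ ∀ x y, y ∈ Feas g x → ‖x - xb‖ < δ → ‖y - yb‖ < δ → P x y) ∧
    (∀ x y, P x y → y ∈ Feas g x → IsLocalMaxOn (f x) (Feas g x) y →
      (MultSetP g (grady f x y) x y).Nonempty) ∧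
    (∀ (βk : ℕ → EuclideanSpace ℝ (Fin m)) (xk : ℕ → EuclideanSpace ℝ (Fin n))
        (yk : ℕ → EuclideanSpace ℝ (Fin m)) (βb : EuclideanSpace ℝ (Fin m)),
      Tendsto βk atTop (𝓝 βb) → Tendsto xk atTop (𝓝 xb) → Tendsto yk atTop (𝓝 yb) →
      (∀ k, (MultSetP g (βk k) (xk k) (yk k)).Nonempty) →
      ∃ (lamk : ℕ → Fin q → ℝ) (φ : ℕ → ℕ) (lamb : Fin q → ℝ),
        StrictMono φ ∧ (∀ k, lamk k ∈ MultSetP g (βk k) (xk k) (yk k)) ∧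
        Tendsto (lamk ∘ φ) atTop (𝓝 lamb) ∧ lamb ∈ MultSetP g βb xb yb)

/-- The multiplier set `M(β, w)` of a (nonparametric) system `{w : G w ≤ 0, H w = 0}`. -/
def MultSetW {W : Type} [NormedAddCommGroup W] [NormedSpace ℝ W] {p p' : ℕ}
    (G : W → Fin p → ℝ) (H : W → Fin p' → ℝ) (β : W →L[ℝ] ℝ) (w : W) :
    Set ((Fin p → ℝ) × (Fin p' → ℝ)) :=
  {lm | (∀ i, 0 ≤ lm.1 i) ∧
    (β - ∑ i, lm.1 i • fderiv ℝ (fun w => G w i) w -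
      ∑ j, lm.2 j • fderiv ℝ (fun w => H w j) w = 0) ∧
    ∑ i, lm.1 i * G w i = 0}

/-- A stable CQ holds at the feasible point `w̄` of the system `{w : G w ≤ 0, H w = 0}`. -/
def StableCQ {W : Type} [NormedAddCommGroup W] [NormedSpace ℝ W] {p p' : ℕ}
    (G : W → Fin p → ℝ) (H : W → Fin p' → ℝ) (wb : W) : Prop :=
  ∃ P : W → Prop,
    (P wb ∧ ∃ δ : ℝ, 0 < δ ∧ ∀ w, (∀ i, G w i ≤ 0) → (∀ j, H w j = 0) → ‖w - wb‖ < δ → P w) ∧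
    (∀ w, P w → (∀ i, G w i ≤ 0) → (∀ j, H w j = 0) →
      ∀ θ : W → ℝ, ContDiff ℝ 1 θ →
        IsLocalMinOn θ {w' | (∀ i, G w' i ≤ 0) ∧ ∀ j, H w' j = 0} w →
        ∃ (lam : Fin p → ℝ) (mu : Fin p' → ℝ), (∀ i, 0 ≤ lam i) ∧
          (fderiv ℝ θ w + ∑ i, lam i • fderiv ℝ (fun w => G w i) w +
            ∑ j, mu j • fderiv ℝ (fun w => H w j) w = 0) ∧
          ∑ i, lam i * G w i = 0) ∧
    (∀ (βk : ℕ → W →L[ℝ] ℝ) (wk : ℕ → W) (βb : W →L[ℝ] ℝ),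
      Tendsto βk atTop (𝓝 βb) → Tendsto wk atTop (𝓝 wb) →
      (∀ k, (∀ i, G (wk k) i ≤ 0) ∧ ∀ j, H (wk k) j = 0) →
      (∀ k, (MultSetW G H (βk k) (wk k)).Nonempty) →
      ∃ (lmk : ℕ → (Fin p → ℝ) × (Fin p' → ℝ)) (φ : ℕ → ℕ) (lmb : (Fin p → ℝ) × (Fin p' → ℝ)),
        StrictMono φ ∧ (∀ k, lmk k ∈ MultSetW G H (βk k) (wk k)) ∧
        Tendsto (lmk ∘ φ) atTop (𝓝 lmb) ∧ lmb ∈ MultSetW G H βb wb)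

/-- Critical cone of `(P_x̄)` at `y` associated with the multiplier `λ`. -/
def CritCone {n m q : ℕ} (g : EuclideanSpace ℝ (Fin n) → EuclideanSpace ℝ (Fin m) → Fin q → ℝ)
    (xb : EuclideanSpace ℝ (Fin n)) (y : EuclideanSpace ℝ (Fin m)) (lam : Fin q → ℝ) :
    Set (EuclideanSpace ℝ (Fin m)) :=
  {d | ∀ i, g xb y i = 0 →
    (0 < lam i → ⟪grady (fun x y => g x y i) xb y, d⟫ = 0) ∧
    (lam i = 0 → ⟪grady (fun x y => g x y i) xb y, d⟫ ≤ 0)}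

/-- Second order sufficient condition at `(y, λ)` for `(P_x̄)`. -/
def SOSC {n m q : ℕ} (f : EuclideanSpace ℝ (Fin n) → EuclideanSpace ℝ (Fin m) → ℝ)
    (g : EuclideanSpace ℝ (Fin n) → EuclideanSpace ℝ (Fin m) → Fin q → ℝ)
    (xb : EuclideanSpace ℝ (Fin n)) (y : EuclideanSpace ℝ (Fin m)) (lam : Fin q → ℝ) : Prop :=
  ∀ d ∈ CritCone g xb y lam, d ≠ 0 → ⟪d, hessyyLu f g xb y lam d⟫ < 0

/-- `(x̄, ȳ)` is a local solution of the minimax problem in the sense of Stackelberg. -/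
def StackelbergLocal {n m q : ℕ} (f : EuclideanSpace ℝ (Fin n) → EuclideanSpace ℝ (Fin m) → ℝ)
    (g : EuclideanSpace ℝ (Fin n) → EuclideanSpace ℝ (Fin m) → Fin q → ℝ)
    (X : Set (EuclideanSpace ℝ (Fin n))) (xb : EuclideanSpace ℝ (Fin n))
    (yb : EuclideanSpace ℝ (Fin m)) : Prop :=
  xb ∈ X ∧ yb ∈ Sol f g xb ∧ IsLocalMinOn (Vfun f g) X xb

/-- Feasible region of the MPEC reformulation `(P_MPEC)`. -/
def MPECFeas {n m q : ℕ} (f : EuclideanSpace ℝ (Fin n) → EuclideanSpace ℝ (Fin m) → ℝ)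
    (g : EuclideanSpace ℝ (Fin n) → EuclideanSpace ℝ (Fin m) → Fin q → ℝ)
    (X : Set (EuclideanSpace ℝ (Fin n))) :
    Set (EuclideanSpace ℝ (Fin n) × EuclideanSpace ℝ (Fin m) × (Fin q → ℝ)) :=
  {w | w.1 ∈ X ∧ gradyL f g w.1 w.2.1 w.2.2 = 0 ∧ (∀ i, g w.1 w.2.1 i ≤ 0) ∧
    (∀ i, 0 ≤ w.2.2 i) ∧ ∑ i, w.2.2 i * g w.1 w.2.1 i = 0}

/-- S-stationarity for `(P_MPEC)`. -/
def SStationary {n m q : ℕ} (f : EuclideanSpace ℝ (Fin n) → EuclideanSpace ℝ (Fin m) → ℝ)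
    (g : EuclideanSpace ℝ (Fin n) → EuclideanSpace ℝ (Fin m) → Fin q → ℝ)
    (X : Set (EuclideanSpace ℝ (Fin n))) (xb : EuclideanSpace ℝ (Fin n))
    (yb : EuclideanSpace ℝ (Fin m)) (lamb : Fin q → ℝ) : Prop :=
  ∃ (u : EuclideanSpace ℝ (Fin m)) (α β : Fin q → ℝ),
    -(gradx f xb yb + ∑ i, α i • gradx (fun x y => g x y i) xb yb +
        hessxyLu f g xb yb lamb u) ∈ limNC X xb ∧
    grady f xb yb + ∑ i, α i • grady (fun x y => g x y i) xb yb +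
      hessyyLu f g xb yb lamb u = 0 ∧
    (∀ i, -(gyTu g xb yb u i) - β i = 0) ∧
    (∀ i, g xb yb i < 0 → lamb i = 0 → α i = 0) ∧
    (∀ i, g xb yb i = 0 → 0 < lamb i → β i = 0) ∧
    (∀ i, g xb yb i = 0 → lamb i = 0 → 0 ≤ α i ∧ 0 ≤ β i)


/-- Optimal value function of the Wolfe dual (`sInf ∅ = ⊤`). -/
def VD {n m q : ℕ} (f : EuclideanSpace ℝ (Fin n) → EuclideanSpace ℝ (Fin m) → ℝ)
    (g : EuclideanSpace ℝ (Fin n) → EuclideanSpace ℝ (Fin m) → Fin q → ℝ)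
    (x : EuclideanSpace ℝ (Fin n)) : EReal :=
  sInf ((fun p : EuclideanSpace ℝ (Fin m) × (Fin q → ℝ) => (Lag f g x p.1 p.2 : EReal)) ''
    {p | gradyL f g x p.1 p.2 = 0 ∧ ∀ i, 0 ≤ p.2 i})

/-- Strict differentiability of an `EReal`-valued function at `x₀` with gradient `ζ`. -/
def StrictDiffAt {n : ℕ} (φ : EuclideanSpace ℝ (Fin n) → EReal)
    (x₀ ζ : EuclideanSpace ℝ (Fin n)) : Prop :=
  ∀ ε : ℝ, 0 < ε → ∃ δ : ℝ, 0 < δ ∧ ∀ x x', ‖x - x₀‖ < δ → ‖x' - x₀‖ < δ →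
    ∃ a b : ℝ, φ x = (a : EReal) ∧ φ x' = (b : EReal) ∧
      |a - b - ⟪ζ, x - x'⟫| ≤ ε * ‖x - x'‖

/-- `f` and `g` are separable with respect to `x` and `y`. -/
def SeparableFG {n m q : ℕ} (f : EuclideanSpace ℝ (Fin n) → EuclideanSpace ℝ (Fin m) → ℝ)
    (g : EuclideanSpace ℝ (Fin n) → EuclideanSpace ℝ (Fin m) → Fin q → ℝ) : Prop :=
  ∃ (f₁ : EuclideanSpace ℝ (Fin n) → ℝ) (f₂ : EuclideanSpace ℝ (Fin m) → ℝ)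
    (g₁ : EuclideanSpace ℝ (Fin n) → Fin q → ℝ) (g₂ : EuclideanSpace ℝ (Fin m) → Fin q → ℝ),
    (∀ x y, f x y = f₁ x + f₂ y) ∧ ∀ x y i, g x y i = g₁ x i + g₂ y i

end

/-- A first order upper estimate of `φ` at `x₀` with slope `w` forces every Fréchet subgradient
to equal `w`. -/
lemma FSub_subset_singleton {n : ℕ} {φ : EuclideanSpace ℝ (Fin n) → EReal}
    {x₀ w : EuclideanSpace ℝ (Fin n)} {c : ℝ} (hc : φ x₀ = c)
    (h : ∀ η : ℝ, 0 < η → ∀ᶠ x in 𝓝 x₀, φ x ≤ ((c + ⟪w, x - x₀⟫ + η * ‖x - x₀‖ : ℝ) : EReal)) :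
    FSub φ x₀ ⊆ {w} := by
  rintro v ⟨c', hc', hv⟩
  obtain rfl : c = c' := by rw [hc] at hc'; exact_mod_cast hc'
  rw [Set.mem_singleton_iff]
  by_contra hne
  have hd : 0 < ‖v - w‖ := norm_pos_iff.2 (sub_ne_zero.2 hne)
  set d := v - w with hd_def
  obtain ⟨δ, hδ, hlow⟩ := hv (‖d‖ / 4) (by positivity)
  obtain ⟨δ', hδ', hup⟩ := Metric.eventually_nhds_iff.1 (h (‖d‖ / 4) (by positivity))
  set t : ℝ := min δ δ' / (2 * ‖d‖) with ht_def
  have hm : 0 < min δ δ' := lt_min hδ hδ'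
  have ht : 0 < t := by positivity
  have htd : t * ‖d‖ < min δ δ' := by
    rw [ht_def]; field_simp; linarith
  have hnorm : ‖x₀ + t • d - x₀‖ = t * ‖d‖ := by
    rw [add_sub_cancel_left, norm_smul, Real.norm_of_nonneg ht.le]
  have h1 := hlow (x₀ + t • d) (by rw [hnorm]; exact htd.trans_le (min_le_left _ _))
  have h2 := hup (y := x₀ + t • d)
    (by rw [dist_eq_norm, hnorm]; exact htd.trans_le (min_le_right _ _))
  have h3 := EReal.coe_le_coe_iff.1 (h1.trans h2)
  rw [hnorm, add_sub_cancel_left, inner_smul_right, inner_smul_right] at h3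
  have h4 : ⟪v, d⟫ - ⟪w, d⟫ = ‖d‖ * ‖d‖ := by
    rw [← inner_sub_left, ← hd_def, real_inner_self_eq_norm_mul_norm]
  have h5 : 0 < t * (‖d‖ * ‖d‖) := by positivity
  have h6 : t * (‖d‖ * ‖d‖) = t * ⟪v, d⟫ - t * ⟪w, d⟫ := by rw [← h4]; ring
  nlinarith

/-- A critical point of a concave function is a global maximizer. -/
lemma ConcaveOn.le_of_hasFDerivAt_zero {E : Type*} [NormedAddCommGroup E] [NormedSpace ℝ E]
    {φ : E → ℝ} (hφ : ConcaveOn ℝ Set.univ φ) {y₀ : E} (h0 : HasFDerivAt φ (0 : E →L[ℝ] ℝ) y₀)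
    (y : E) : φ y ≤ φ y₀ := by
  have hk : ConcaveOn ℝ Set.univ (φ ∘ AffineMap.lineMap (k := ℝ) y₀ y) :=
    hφ.comp_affineMap _
  have hd : HasDerivAt (φ ∘ AffineMap.lineMap (k := ℝ) y₀ y) 0 0 := by
    have h0' : HasFDerivAt φ (0 : E →L[ℝ] ℝ) (AffineMap.lineMap (k := ℝ) y₀ y 0) := by
      simpa using h0
    simpa using h0'.comp_hasDerivAt (0 : ℝ) AffineMap.hasDerivAt_lineMap
  have := hk.slope_le_of_hasDerivAt (Set.mem_univ _) (Set.mem_univ _) (zero_lt_one (α := ℝ)) hd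
  simpa [slope_def_field] using this

/-- The augmented Lagrangian penalty with multiplier `l`, minus its linear part `l * s`. -/
noncomputable def penaltyResidual (l s : ℝ) : ℝ := ((max 0 (l + s)) ^ 2 - l ^ 2) / 2 - l * s

lemma penaltyResidual_nonneg {l : ℝ} (hl : 0 ≤ l) (s : ℝ) : 0 ≤ penaltyResidual l s := by
  unfold penaltyResidual
  rcases max_cases 0 (l + s) with ⟨h, h'⟩ | ⟨h, h'⟩ <;> rw [h] <;>
    nlinarith [sq_nonneg s]

lemma mul_add_penaltyResidual_nonpos {l s : ℝ} (hl : 0 ≤ l) (hs : s ≤ 0) :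
    l * s + penaltyResidual l s ≤ 0 := by
  unfold penaltyResidual
  rcases max_cases 0 (l + s) with ⟨h, h'⟩ | ⟨h, h'⟩ <;> rw [h] <;> nlinarith

lemma penaltyResidual_eq_zero {l s : ℝ} (hl : 0 ≤ l) (h : s = 0 ∨ l = 0 ∧ s ≤ 0) :
    penaltyResidual l s = 0 := by
  unfold penaltyResidual
  rcases h with rfl | ⟨rfl, hs⟩
  · simp [hl]
  · simp [hs]

lemma nonpos_of_penaltyResidual_eq_zero {l s : ℝ} (h : penaltyResidual l s = 0) (hl : 0 ≤ l) :
    s ≤ 0 := by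
  unfold penaltyResidual at h
  by_contra! hs
  rw [max_eq_right (by linarith)] at h
  nlinarith

lemma eq_zero_of_penaltyResidual_eq_zero {l s : ℝ} (h : penaltyResidual l s = 0) (hl : 0 < l) :
    s = 0 := by
  unfold penaltyResidual at h
  rcases max_cases 0 (l + s) with ⟨h1, h'⟩ | ⟨h1, h'⟩ <;> rw [h1] at h
  · nlinarith
  · exact pow_eq_zero_iff two_ne_zero |>.1 (by nlinarith : s ^ 2 = 0)

lemma continuous_penaltyResidual (l : ℝ) : Continuous (penaltyResidual l) := by
  unfold penaltyResidual; fun_prop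

lemma hasDerivAt_penaltyResidual (l s : ℝ) :
    HasDerivAt (penaltyResidual l) (max 0 (l + s) - l) s := by
  rw [hasDerivAt_iff_isLittleO]
  refine Asymptotics.IsBigO.trans_isLittleO (g := fun s' => ‖s' - s‖ ^ 2) ?_
    (by simpa using (Asymptotics.isLittleO_pow_sub_sub s (one_lt_two)))
  refine Asymptotics.IsBigO.of_bound 1 (Eventually.of_forall fun s' => ?_)
  simp only [penaltyResidual, smul_eq_mul, Real.norm_eq_abs, sq_abs, one_mul,
    abs_of_nonneg (sq_nonneg (s' - s))]
  rw [abs_le]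
  rcases max_cases 0 (l + s) with ⟨h, h'⟩ | ⟨h, h'⟩ <;>
    rcases max_cases 0 (l + s') with ⟨h1, h1'⟩ | ⟨h1, h1'⟩ <;> rw [h, h1] <;>
    constructor <;> nlinarith [sq_nonneg (s' - s)]

lemma hasStrictDerivAt_penaltyResidual {l s : ℝ} (hl : 0 ≤ l) (h : s = 0 ∨ l = 0 ∧ s ≤ 0) :
    HasStrictDerivAt (penaltyResidual l) 0 s := by
  have h0 : max 0 (l + s) - l = 0 := by
    rcases h with rfl | ⟨rfl, hs⟩
    · simp [hl]
    · simp [hs]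
  have := hasStrictDerivAt_of_hasDerivAt_of_continuousAt (f := penaltyResidual l) (x := s)
    (Eventually.of_forall fun s' => hasDerivAt_penaltyResidual l s') (by fun_prop)
  rwa [h0] at this

lemma convexOn_mul_add_penaltyResidual {E : Type*} [AddCommGroup E] [Module ℝ E] {φ : E → ℝ}
    (hφ : ConvexOn ℝ Set.univ φ) (l : ℝ) :
    ConvexOn ℝ Set.univ (fun y => l * φ y + penaltyResidual l (φ y)) := by
  have h1 : ConvexOn ℝ Set.univ ((fun _ => (0 : ℝ)) ⊔ fun y => l + φ y) :=
    (convexOn_const 0 convex_univ).sup ((convexOn_const l convex_univ).add hφ)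
  have h2 := ((h1.pow (fun y _ => le_max_left _ _) 2).smul (c := (1 / 2 : ℝ)) (by norm_num)).add
    (convexOn_const (-(l ^ 2) / 2) convex_univ)
  refine h2.congr fun y _ => ?_
  simp [penaltyResidual]
  ring

/-- One-sided Danskin estimate: if `F (x, ·)` is concave for `x` near `x₀` and `F (x₀, ·)` has the
unique maximizer `y₀`, then `x ↦ sup F (x, ·)` has a first order upper estimate at `x₀` given by the
partial derivative of `F` at `(x₀, y₀)`. -/
lemma eventually_forall_le_of_concave {E G : Type*} [NormedAddCommGroup E] [NormedSpace ℝ E]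
    [NormedAddCommGroup G] [NormedSpace ℝ G] [ProperSpace G] {F : E × G → ℝ}
    {F' : E × G →L[ℝ] ℝ} {x₀ : E} {y₀ : G} (hF : Continuous F)
    (hF' : HasStrictFDerivAt F F' (x₀, y₀))
    (hconc : ∀ᶠ x in 𝓝 x₀, ConcaveOn ℝ Set.univ fun y => F (x, y))
    (hmax : ∀ y, y ≠ y₀ → F (x₀, y) < F (x₀, y₀)) {η : ℝ} (hη : 0 < η) :
    ∀ᶠ x in 𝓝 x₀, ∀ y, F (x, y) ≤ F (x₀, y₀) + F' (x - x₀, 0) + η * ‖x - x₀‖ := by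
  obtain ⟨δ, hδ, hs⟩ := Metric.eventually_nhds_iff.1 (hF'.isLittleO.bound hη)
  set ρ := δ / 2 with hρ_def
  have hρ : 0 < ρ := by positivity
  have hsphere : ∀ᶠ x in 𝓝 x₀, ∀ y ∈ sphere y₀ ρ, F (x, y) < F (x, y₀) := by
    refine (isCompact_sphere y₀ ρ).eventually_forall_of_forall_eventually fun y hy => ?_
    have hne : y ≠ y₀ := by
      rintro rfl
      simp [hρ.ne] at hy
    exact (hF.continuousAt (x := (x₀, y))).eventually_lt
      (g := fun z : E × G => F (z.1, y₀)) (by fun_prop) (hmax y hne)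
  filter_upwards [hconc, hsphere, Metric.ball_mem_nhds x₀ hδ] with x hc hx hxδ
  have hball : ∀ y, ‖y - y₀‖ ≤ ρ →
      F (x, y) ≤ F (x₀, y₀) + F' (x - x₀, 0) + η * ‖x - x₀‖ := by
    intro y hy
    have hyδ : dist y y₀ < δ := by rw [dist_eq_norm]; linarith
    have h := hs (y := ((x, y), (x₀, y))) (by
      simp only [Prod.dist_eq]
      simp [hyδ, mem_ball.1 hxδ])
    simp only [Prod.mk_sub_mk, sub_self, Prod.norm_mk, norm_zero, norm_nonneg, sup_of_le_left] at h
    have h' := (abs_le.1 h).2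
    have : F (x₀, y) ≤ F (x₀, y₀) := by
      by_cases hyy : y = y₀
      · rw [hyy]
      · exact (hmax y hyy).le
    linarith
  intro y
  rcases le_or_gt ‖y - y₀‖ ρ with hy | hy
  · exact hball y hy
  · have hpos : 0 < ‖y - y₀‖ := hρ.trans hy
    set s := ρ / ‖y - y₀‖ with hs_def
    have hs0 : 0 < s := by positivity
    have hs1 : s < 1 := (div_lt_one hpos).2 hy
    have hz : (1 - s) • y₀ + s • y = y₀ + s • (y - y₀) := by module
    have h1 := hc.2 (Set.mem_univ y₀) (Set.mem_univ y) (sub_nonneg.2 hs1.le) hs0.le (by ring)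
    have h2 := hx (y₀ + s • (y - y₀)) (by
      rw [mem_sphere, dist_eq_norm, add_sub_cancel_left, norm_smul, Real.norm_of_nonneg hs0.le,
        hs_def]
      field_simp)
    simp only [hz, smul_eq_mul] at h1
    have h3 : F (x, y) ≤ F (x, y₀) := by nlinarith
    exact h3.trans (hball y₀ (by simpa using hρ.le))

/-- If a differentiable function is constant on a segment starting at a critical point, its second
derivative along the segment vanishes at that point. -/
lemma inner_gradient_inner_gradient_eq_zero {m : ℕ} {φ : EuclideanSpace ℝ (Fin m) → ℝ}
    {y d : EuclideanSpace ℝ (Fin m)} (hφ : Differentiable ℝ φ) (h0 : gradient φ y = 0)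
    (hconst : ∀ t ∈ Set.Icc (0 : ℝ) 1, φ (y + t • d) = φ y) :
    ⟪d, gradient (fun z => ⟪gradient φ z, d⟫) y⟫ = 0 := by
  by_cases hG : DifferentiableAt ℝ (fun z => ⟪gradient φ z, d⟫) y
  swap
  · rw [gradient_eq_zero_of_not_differentiableAt hG, inner_zero_right]
  have hline : ∀ t : ℝ, HasDerivAt (fun t : ℝ => y + t • d) d t := fun t => by
    simpa using ((hasDerivAt_id t).smul_const d).const_add y
  have hzero : ∀ t ∈ Set.Ico (0 : ℝ) 1, ⟪gradient φ (y + t • d), d⟫ = 0 := by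
    rintro t ⟨ht0, ht1⟩
    rcases ht0.eq_or_lt with rfl | ht0
    · simp [h0]
    have h1 := (hφ (y + t • d)).hasFDerivAt.comp_hasDerivAt t (hline t)
    have h2 : (φ ∘ fun t : ℝ => y + t • d) =ᶠ[𝓝 t] fun _ => φ y := by
      filter_upwards [Icc_mem_nhds ht0 ht1] with t' ht' using hconst t' ht'
    rw [inner_gradient_left]
    exact h1.unique ((hasDerivAt_const t (φ y)).congr_of_eventuallyEq h2)
  have hG0 : HasFDerivAt (fun z => ⟪gradient φ z, d⟫) (fderiv ℝ (fun z => ⟪gradient φ z, d⟫) y)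
      (y + (0 : ℝ) • d) := by simpa using hG.hasFDerivAt
  have h1 := (hG0.comp_hasDerivAt (0 : ℝ) (hline 0)).hasDerivWithinAt (s := Set.Ico 0 1)
  have h2 : HasDerivWithinAt ((fun z => ⟪gradient φ z, d⟫) ∘ fun t : ℝ => y + t • d) 0
      (Set.Ico 0 1) 0 :=
    (hasDerivWithinAt_const (0 : ℝ) (Set.Ico 0 1) (0 : ℝ)).congr (fun t ht => hzero t ht)
      (hzero 0 (by simp))
  rw [real_inner_comm, inner_gradient_left]
  exact (uniqueDiffOn_Ico (0 : ℝ) 1 0 (by simp)).eq_deriv _ h1 h2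

/-- A differentiable function attaining its maximum over a segment at the initial point has a
nonpositive derivative there along the segment. -/
lemma inner_gradient_nonpos {m : ℕ} {φ : EuclideanSpace ℝ (Fin m) → ℝ}
    {y d : EuclideanSpace ℝ (Fin m)} (hφ : DifferentiableAt ℝ φ y)
    (hle : ∀ t ∈ Set.Icc (0 : ℝ) 1, φ (y + t • d) ≤ φ y) : ⟪gradient φ y, d⟫ ≤ 0 := by
  rw [inner_gradient_left]
  have hmax : IsLocalMaxOn φ (segment ℝ y (y + d)) y := by
    refine Filter.eventually_inf_principal.2 (Eventually.of_forall fun z hz => ?_)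
    rw [segment_eq_image'] at hz
    obtain ⟨t, ht, rfl⟩ := hz
    simpa using hle t ht
  exact hmax.hasFDerivWithinAt_nonpos hφ.hasFDerivAt.hasFDerivWithinAt
    (mem_posTangentConeAt_of_segment_subset subset_rfl)

lemma Vfun_le {n m q : ℕ} {f : EuclideanSpace ℝ (Fin n) → EuclideanSpace ℝ (Fin m) → ℝ}
    {g : EuclideanSpace ℝ (Fin n) → EuclideanSpace ℝ (Fin m) → Fin q → ℝ}
    {x : EuclideanSpace ℝ (Fin n)} {r : ℝ} (h : ∀ y ∈ Feas g x, f x y ≤ r) :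
    Vfun f g x ≤ (r : EReal) :=
  sSup_le (by rintro _ ⟨y, hy, rfl⟩; exact EReal.coe_le_coe_iff.2 (h y hy))

lemma convexOn_finset_sum {E ι : Type*} [AddCommGroup E] [Module ℝ E] {s : Set E}
    (hs : Convex ℝ s) {t : Finset ι} {φ : ι → E → ℝ} (hφ : ∀ i, ConvexOn ℝ s (φ i)) :
    ConvexOn ℝ s (∑ i ∈ t, φ i) :=
  Finset.sum_induction _ (ConvexOn ℝ s) (fun _ _ => ConvexOn.add) (convexOn_const 0 hs)
    fun i _ => hφ i

lemma contDiff_Lag {n m q : ℕ} {f : EuclideanSpace ℝ (Fin n) → EuclideanSpace ℝ (Fin m) → ℝ}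
    {g : EuclideanSpace ℝ (Fin n) → EuclideanSpace ℝ (Fin m) → Fin q → ℝ} {k : WithTop ℕ∞}
    (hf : ContDiff ℝ k
      (fun p : EuclideanSpace ℝ (Fin n) × EuclideanSpace ℝ (Fin m) => f p.1 p.2))
    (hg : ∀ i, ContDiff ℝ k
      (fun p : EuclideanSpace ℝ (Fin n) × EuclideanSpace ℝ (Fin m) => g p.1 p.2 i))
    (lam : Fin q → ℝ) :
    ContDiff ℝ k
      (fun p : EuclideanSpace ℝ (Fin n) × EuclideanSpace ℝ (Fin m) => Lag f g p.1 p.2 lam) :=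
  hf.sub (ContDiff.sum fun i _ => contDiff_const.mul (hg i))

lemma concaveOn_Lag {n m q : ℕ} {f : EuclideanSpace ℝ (Fin n) → EuclideanSpace ℝ (Fin m) → ℝ}
    {g : EuclideanSpace ℝ (Fin n) → EuclideanSpace ℝ (Fin m) → Fin q → ℝ}
    {x : EuclideanSpace ℝ (Fin n)} {lam : Fin q → ℝ} (hf : ConcaveOn ℝ Set.univ (f x))
    (hg : ∀ i, ConvexOn ℝ Set.univ (fun y => g x y i)) (hlam : ∀ i, 0 ≤ lam i) :
    ConcaveOn ℝ Set.univ (fun y => Lag f g x y lam) := by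
  refine ConcaveOn.congr (hf.sub (convexOn_finset_sum (t := Finset.univ) convex_univ
    fun i => (hg i).smul (hlam i))) fun y _ => ?_
  simp [Lag]

/-- The augmented Lagrangian of `(P_x)` with base multiplier `lam` and penalty parameter `1`. -/
noncomputable def augLag {n m q : ℕ} (f : EuclideanSpace ℝ (Fin n) → EuclideanSpace ℝ (Fin m) → ℝ)
    (g : EuclideanSpace ℝ (Fin n) → EuclideanSpace ℝ (Fin m) → Fin q → ℝ) (lam : Fin q → ℝ)
    (p : EuclideanSpace ℝ (Fin n) × EuclideanSpace ℝ (Fin m)) : ℝ :=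
  Lag f g p.1 p.2 lam - ∑ i, penaltyResidual (lam i) (g p.1 p.2 i)

lemma augLag_le_Lag {n m q : ℕ} (f : EuclideanSpace ℝ (Fin n) → EuclideanSpace ℝ (Fin m) → ℝ)
    (g : EuclideanSpace ℝ (Fin n) → EuclideanSpace ℝ (Fin m) → Fin q → ℝ) {lam : Fin q → ℝ}
    (hlam : ∀ i, 0 ≤ lam i) (p : EuclideanSpace ℝ (Fin n) × EuclideanSpace ℝ (Fin m)) :
    augLag f g lam p ≤ Lag f g p.1 p.2 lam :=
  sub_le_self _ (Finset.sum_nonneg fun i _ => penaltyResidual_nonneg (hlam i) _)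

lemma augLag_eq {n m q : ℕ} (f : EuclideanSpace ℝ (Fin n) → EuclideanSpace ℝ (Fin m) → ℝ)
    (g : EuclideanSpace ℝ (Fin n) → EuclideanSpace ℝ (Fin m) → Fin q → ℝ) (lam : Fin q → ℝ)
    (p : EuclideanSpace ℝ (Fin n) × EuclideanSpace ℝ (Fin m)) :
    augLag f g lam p =
      f p.1 p.2 - ∑ i, (lam i * g p.1 p.2 i + penaltyResidual (lam i) (g p.1 p.2 i)) := by
  rw [augLag, Lag, Finset.sum_add_distrib, sub_sub]

lemma le_augLag {n m q : ℕ} {f : EuclideanSpace ℝ (Fin n) → EuclideanSpace ℝ (Fin m) → ℝ}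
    {g : EuclideanSpace ℝ (Fin n) → EuclideanSpace ℝ (Fin m) → Fin q → ℝ} {lam : Fin q → ℝ}
    (hlam : ∀ i, 0 ≤ lam i) {x : EuclideanSpace ℝ (Fin n)} {y : EuclideanSpace ℝ (Fin m)}
    (hy : y ∈ Feas g x) : f x y ≤ augLag f g lam (x, y) := by
  rw [augLag_eq, le_sub_self_iff]
  exact Finset.sum_nonpos fun i _ => mul_add_penaltyResidual_nonpos (hlam i) (hy i)

lemma concaveOn_augLag {n m q : ℕ}
    {f : EuclideanSpace ℝ (Fin n) → EuclideanSpace ℝ (Fin m) → ℝ}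
    {g : EuclideanSpace ℝ (Fin n) → EuclideanSpace ℝ (Fin m) → Fin q → ℝ}
    {x : EuclideanSpace ℝ (Fin n)} (lam : Fin q → ℝ) (hf : ConcaveOn ℝ Set.univ (f x))
    (hg : ∀ i, ConvexOn ℝ Set.univ (fun y => g x y i)) :
    ConcaveOn ℝ Set.univ (fun y => augLag f g lam (x, y)) := by
  refine ConcaveOn.congr (hf.sub (convexOn_finset_sum (t := Finset.univ) convex_univ
    fun i => convexOn_mul_add_penaltyResidual (hg i) (lam i))) fun y _ => ?_
  simp [augLag_eq]

/-- Complementary slackness, read off componentwise from a multiplier. -/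
lemma eq_zero_or_of_mem_SigmaSet {n m q : ℕ}
    {f : EuclideanSpace ℝ (Fin n) → EuclideanSpace ℝ (Fin m) → ℝ}
    {g : EuclideanSpace ℝ (Fin n) → EuclideanSpace ℝ (Fin m) → Fin q → ℝ}
    {x : EuclideanSpace ℝ (Fin n)} {y : EuclideanSpace ℝ (Fin m)} {lam : Fin q → ℝ}
    (h : lam ∈ SigmaSet f g x y) (i : Fin q) : g x y i = 0 ∨ lam i = 0 ∧ g x y i ≤ 0 := by
  obtain ⟨-, hl, hg, hs⟩ := h
  have := (Finset.sum_eq_zero_iff_of_nonpos fun i _ =>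
    mul_nonpos_of_nonneg_of_nonpos (hl i) (hg i)).1 hs i (Finset.mem_univ i)
  rcases mul_eq_zero.1 this with h | h
  · exact Or.inr ⟨h, hg i⟩
  · exact Or.inl h

/-- Under convexity, the augmented Lagrangian at a multiplier satisfying SOSC has a unique
maximizer. -/
lemma augLag_lt_of_SOSC {n m q : ℕ}
    {f : EuclideanSpace ℝ (Fin n) → EuclideanSpace ℝ (Fin m) → ℝ}
    {g : EuclideanSpace ℝ (Fin n) → EuclideanSpace ℝ (Fin m) → Fin q → ℝ}
    {x : EuclideanSpace ℝ (Fin n)} {y : EuclideanSpace ℝ (Fin m)} {lam : Fin q → ℝ}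
    (hL : Differentiable ℝ fun y => Lag f g x y lam)
    (hg : ∀ i, Differentiable ℝ fun y => g x y i)
    (hfc : ConcaveOn ℝ Set.univ (f x)) (hgc : ∀ i, ConvexOn ℝ Set.univ (fun y => g x y i))
    (hlam : lam ∈ SigmaSet f g x y) (hsosc : SOSC f g x y lam)
    (hmax : ∀ z, Lag f g x z lam ≤ Lag f g x y lam)
    {z : EuclideanSpace ℝ (Fin m)} (hz : z ≠ y) :
    augLag f g lam (x, z) < augLag f g lam (x, y) := by
  have hcs := eq_zero_or_of_mem_SigmaSet hlam
  obtain ⟨hgrad, hl, -, -⟩ := hlam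
  have hy : augLag f g lam (x, y) = Lag f g x y lam := by
    simp [augLag, Finset.sum_eq_zero fun i _ => penaltyResidual_eq_zero (hl i) (hcs i)]
  by_contra! hle
  set d := z - y with hd_def
  have hseg : ∀ t ∈ Set.Icc (0 : ℝ) 1, Lag f g x (y + t • d) lam = Lag f g x y lam ∧
      ∀ i, penaltyResidual (lam i) (g x (y + t • d) i) = 0 := by
    rintro t ⟨ht0, ht1⟩
    have h1 := (concaveOn_augLag lam hfc hgc).2 (Set.mem_univ y) (Set.mem_univ z)
      (sub_nonneg.2 ht1) ht0 (by ring)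
    rw [show (1 - t) • y + t • z = y + t • d by rw [hd_def]; module] at h1
    simp only [smul_eq_mul] at h1
    have h2 := augLag_le_Lag f g hl (x, y + t • d)
    have h3 := hmax (y + t • d)
    have h4 : augLag f g lam (x, y) ≤ augLag f g lam (x, y + t • d) := by nlinarith
    have h5 : Lag f g x (y + t • d) lam = Lag f g x y lam := le_antisymm h3 (by
      simp only at h2; linarith)
    refine ⟨h5, fun i => ?_⟩
    have h6 : ∑ i, penaltyResidual (lam i) (g x (y + t • d) i) = 0 := by
      refine le_antisymm ?_ (Finset.sum_nonneg fun i _ => penaltyResidual_nonneg (hl i) _)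
      rw [hy, augLag, h5] at h4
      linarith
    exact (Finset.sum_eq_zero_iff_of_nonneg fun i _ => penaltyResidual_nonneg (hl i) _).1 h6 i
      (Finset.mem_univ i)
  have hcrit : d ∈ CritCone g x y lam := by
    refine fun i hi => ⟨fun hpos => ?_, fun hzero => ?_⟩
    · have h0 : ∀ t ∈ Set.Icc (0 : ℝ) 1, g x (y + t • d) i = 0 := fun t ht =>
        eq_zero_of_penaltyResidual_eq_zero ((hseg t ht).2 i) hpos
      refine le_antisymm (inner_gradient_nonpos (hg i y) fun t ht => by simp [h0 t ht, hi]) ?_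
      have h1 := inner_gradient_nonpos (φ := fun y => -g x y i) (d := d) (hg i y).neg
        fun t ht => by rw [h0 t ht, hi]
      rw [inner_gradient_left, fderiv_fun_neg] at h1
      rw [grady, inner_gradient_left]
      simpa using h1
    · exact inner_gradient_nonpos (hg i y) fun t ht => by
        simpa [hi] using nonpos_of_penaltyResidual_eq_zero ((hseg t ht).2 i) (hl i)
  refine (hsosc d hcrit (sub_ne_zero.2 hz)).ne ?_
  exact inner_gradient_inner_gradient_eq_zero hL hgrad fun t ht => (hseg t ht).1

lemma hasStrictFDerivAt_augLag {n m q : ℕ}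
    {f : EuclideanSpace ℝ (Fin n) → EuclideanSpace ℝ (Fin m) → ℝ}
    {g : EuclideanSpace ℝ (Fin n) → EuclideanSpace ℝ (Fin m) → Fin q → ℝ}
    {x : EuclideanSpace ℝ (Fin n)} {y : EuclideanSpace ℝ (Fin m)} {lam : Fin q → ℝ}
    {L' : EuclideanSpace ℝ (Fin n) × EuclideanSpace ℝ (Fin m) →L[ℝ] ℝ}
    (hL : HasStrictFDerivAt (fun p : EuclideanSpace ℝ (Fin n) × EuclideanSpace ℝ (Fin m) =>
      Lag f g p.1 p.2 lam) L' (x, y))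
    (hg : ∀ i, ContDiff ℝ 1
      (fun p : EuclideanSpace ℝ (Fin n) × EuclideanSpace ℝ (Fin m) => g p.1 p.2 i))
    (hlam : lam ∈ SigmaSet f g x y) : HasStrictFDerivAt (augLag f g lam) L' (x, y) := by
  have h1 : ∀ i, HasStrictFDerivAt
      (fun p : EuclideanSpace ℝ (Fin n) × EuclideanSpace ℝ (Fin m) =>
        penaltyResidual (lam i) (g p.1 p.2 i)) 0 (x, y) := fun i => by
    simpa [Function.comp_def] using HasStrictDerivAt.comp_hasStrictFDerivAt
      (f := fun p : EuclideanSpace ℝ (Fin n) × EuclideanSpace ℝ (Fin m) => g p.1 p.2 i) (x, y)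
      (hasStrictDerivAt_penaltyResidual (hlam.2.1 i) (eq_zero_or_of_mem_SigmaSet hlam i))
      ((hg i).contDiffAt.hasStrictFDerivAt one_ne_zero)
  simpa using! hL.sub (HasStrictFDerivAt.fun_sum (u := Finset.univ) fun i _ => h1 i)

/-- Corollary 3.4 — regular subdifferential estimate under separability or SOSC. -/
theorem stmt10 {n m q : ℕ}
    (f : EuclideanSpace ℝ (Fin n) → EuclideanSpace ℝ (Fin m) → ℝ)
    (g : EuclideanSpace ℝ (Fin n) → EuclideanSpace ℝ (Fin m) → Fin q → ℝ)
    (hf : ContDiff ℝ 2 (fun p : EuclideanSpace ℝ (Fin n) × EuclideanSpace ℝ (Fin m) => f p.1 p.2))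
    (hg : ∀ i, ContDiff ℝ 2
      (fun p : EuclideanSpace ℝ (Fin n) × EuclideanSpace ℝ (Fin m) => g p.1 p.2 i))
    (xb : EuclideanSpace ℝ (Fin n))
    (hconv : ∃ δ : ℝ, 0 < δ ∧ ∀ x ∈ Metric.ball xb δ,
      ConcaveOn ℝ Set.univ (f x) ∧ ∀ i, ConvexOn ℝ Set.univ (fun y => g x y i))
    (yb : EuclideanSpace ℝ (Fin m)) (lamb : Fin q → ℝ)
    (hyb : yb ∈ Sol f g xb) (hlamb : lamb ∈ SigmaSet f g xb yb)
    (halt : (SeparableFG f g ∧ CQAt (WolfeG n m q) (WolfeH f g) (xb, yb, lamb)) ∨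
      SOSC f g xb yb lamb) :
    FSub (Vfun f g) xb ⊆ {gradxL f g xb yb lamb} := by
  obtain ⟨hyb_feas, hV⟩ := id hyb
  obtain ⟨hgrad, hl, -, hcs⟩ := id hlamb
  obtain ⟨δ, hδ, hconv⟩ := hconv
  have hΛ := contDiff_Lag hf hg lamb
  have hLy : Differentiable ℝ fun y => Lag f g xb y lamb :=
    (hΛ.differentiable two_ne_zero).comp (by fun_prop : Differentiable ℝ fun y => (xb, y))
  have hLx : Differentiable ℝ fun x => Lag f g x yb lamb :=
    (hΛ.differentiable two_ne_zero).comp (by fun_prop : Differentiable ℝ fun x => (x, yb))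
  have hgy : ∀ i, Differentiable ℝ fun y => g xb y i := fun i =>
    ((hg i).differentiable two_ne_zero).comp (by fun_prop : Differentiable ℝ fun y => (xb, y))
  have hbase := hconv xb (mem_ball_self hδ)
  have hmax : ∀ z, Lag f g xb z lamb ≤ Lag f g xb yb lamb := by
    refine (concaveOn_Lag hbase.1 hbase.2 hl).le_of_hasFDerivAt_zero ?_
    have h := (hLy yb).hasGradientAt
    rw [show gradient (fun y => Lag f g xb y lamb) yb = 0 from hgrad] at h
    simpa using h.hasFDerivAt
  have hLb : Lag f g xb yb lamb = f xb yb := by rw [Lag, hcs, sub_zero]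
  refine FSub_subset_singleton hV.symm fun η hη => ?_
  rcases halt with ⟨⟨f₁, f₂, g₁, g₂, hfs, hgs⟩, -⟩ | hsosc
  · have hgx := (hLx xb).hasGradientAt
    filter_upwards [(hasGradientAt_iff_isLittleO.1 hgx).bound hη] with x hx
    refine Vfun_le fun y hy => ?_
    have h1 : f x y ≤ Lag f g x y lamb := by
      rw [Lag, le_sub_self_iff]
      exact Finset.sum_nonpos fun i _ => mul_nonpos_of_nonneg_of_nonpos (hl i) (hy i)
    have h2 : Lag f g x y lamb - Lag f g x yb lamb = Lag f g xb y lamb - Lag f g xb yb lamb := by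
      simp only [Lag, hfs, hgs, mul_add, Finset.sum_add_distrib]
      ring
    have h3 := (abs_le.1 hx).2
    have h4 := hmax y
    change _ ≤ f xb yb + ⟪gradient (fun x => Lag f g x yb lamb) xb, x - xb⟫ + _
    linarith
  · have hstrict := hasStrictFDerivAt_augLag (x := xb) (y := yb)
      (hΛ.contDiffAt.hasStrictFDerivAt two_ne_zero) (fun i => (hg i).of_le one_le_two) hlamb
    have hcont : Continuous (augLag f g lamb) :=
      hΛ.continuous.sub (continuous_finsetSum _ fun i _ =>
        (continuous_penaltyResidual (lamb i)).comp (hg i).continuous)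
    have hconc : ∀ᶠ x in 𝓝 xb, ConcaveOn ℝ Set.univ fun y => augLag f g lamb (x, y) := by
      filter_upwards [ball_mem_nhds xb hδ] with x hx
      exact concaveOn_augLag lamb (hconv x hx).1 (hconv x hx).2
    filter_upwards [eventually_forall_le_of_concave hcont hstrict hconc
      (fun z hz => augLag_lt_of_SOSC hLy hgy hbase.1 hbase.2 hlamb hsosc hmax hz) hη] with x hx
    refine Vfun_le fun y hy => (le_augLag hl hy).trans ((hx y).trans ?_)
    have h1 : augLag f g lamb (xb, yb) ≤ f xb yb := hLb ▸ augLag_le_Lag f g hl (xb, yb)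
    have h2 : ⟪gradxL f g xb yb lamb, x - xb⟫ =
        fderiv ℝ (fun p : EuclideanSpace ℝ (Fin n) × EuclideanSpace ℝ (Fin m) =>
          Lag f g p.1 p.2 lamb) (xb, yb) (x - xb, 0) := by
      rw [gradxL, gradx, inner_gradient_left]
      have h := (hΛ.differentiable two_ne_zero (xb, yb)).hasFDerivAt.comp xb
        (hasFDerivAt_prodMk_left (𝕜 := ℝ) xb yb)
      have h' := congrArg (fun A => A (x - xb)) h.fderiv
      simpa [Function.comp_def] using h'
    rw [h2]
    linarith
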